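/- Lemma 1 (Differential LPV controller synthesis): Consider the LPV plant δx_{k+1} = A(ρ_k) δx_k + B_w δw_k + B_u δu_k, δz_k = C_z(ρ_k) δx_k + D_zw δw_k + D_zu δu_k, δy_k = C_y δx_k + D_yw δw_k with scheduling set 𝒫 ⊆ ℝ^{n_ρ} and state dimension n_x. Suppose there exist γ > 0, symmetric positive definite P_x, P_z ∈ ℝ^{n_x×n_x}, matrices P_y, J, N, S ∈ ℝ^{n_x×n_x}, and matrix functions U(ρ) ∈ ℝ^{n_x×n_x}, V(ρ) ∈ ℝ^{n_x×n_y}, W(ρ) ∈ ℝ^{n_u×n_x}, X(ρ) ∈ ℝ^{n_u×n_y} such that for all ρ ∈ 𝒫 the block matrix [[𝒫, 𝒜(ρ), ℬ(ρ), 0], [𝒜(ρ)ᵀ, G, 0, 𝒞(ρ)ᵀ], [ℬ(ρ)ᵀ, 0, γ I, 𝒟(ρ)ᵀ], [0, 𝒞(ρ), 𝒟(ρ), γ I]] is positive definite, where 𝒫 = [[P_x, P_y], [P_yᵀ, P_z]], G = [[J + Jᵀ − P_x, I + Sᵀ − P_y], [I + S − P_yᵀ, N + Nᵀ − P_z]],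 𝒜(ρ) = [[A(ρ)J + B_u W(ρ), A(ρ) + B_u X(ρ) C_y], [U(ρ), N A(ρ) + V(ρ) C_y]], ℬ(ρ) = [[B_w + B_u X(ρ) D_yw], [N B_w + V(ρ) D_yw]], 𝒞(ρ) = [C_z(ρ) J + D_zu W(ρ), C_z(ρ) + D_zu X(ρ) C_y], 𝒟(ρ) = D_zw + D_zu X(ρ) D_yw. Assume further that S − N J is invertible, and let R, L be invertible matrices with S = N J + R L. Then the controller matrices defined by [[A_{δc}(ρ), B_{δc}(ρ)], [C_{δc}(ρ), D_{δc}(ρ)]] = [[R, N B_u], [0, I]]⁻¹ (Θ(ρ)) [[L, 0], [C_y J, I]]⁻¹ with Θ(ρ) = [[U(ρ), V(ρ)], [W(ρ), X(ρ)]] − [[N A(ρ) J, 0], [0, 0]] render the closed-loop interconnection (δu = δy_c, δu_c = δy, controller δx_{c,k+1} = A_{δc}(ρ_k) δx_{c,k} + B_{δc}(ρ_k) δu_{c,k}, δy_{c,k} = C_{δc}(ρ_k) δx_{c,k} + D_{δc}(ρ_k) δu_{c,k}) ℓ₂-gain stable with gain at most γ: there exists a symmetric positive definite matrix 𝒬 on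 the closed-loop state space such that for every scheduling sequence ρ : ℕ → 𝒫 and every closed-loop trajectory with δw square-summable, ‖δz‖₂ ≤ γ ‖δw‖₂ + sqrt(γ · δχ₀ᵀ 𝒬 δχ₀), where δχ₀ = (δx₀, δx_{c,0}). -/

import Mathlib

open Matrix Set

/-- Summed dissipation inequality: a nonnegative storage `V` with supply rate `γ w - γ⁻¹ z`
bounds the root of the accumulated output. -/
theorem summable_and_sqrt_tsum_le_of_dissipation {γ : ℝ} (hγ : 0 < γ) {V w z : ℕ → ℝ}
    (hV : ∀ k, 0 ≤ V k) (hw : ∀ k, 0 ≤ w k) (hz : ∀ k, 0 ≤ z k) (hws : Summable w)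
    (h : ∀ k, V (k + 1) ≤ V k + γ * w k - γ⁻¹ * z k) :
    Summable z ∧ √(∑' k, z k) ≤ γ * √(∑' k, w k) + √(γ * V 0) := by
  have hstep : ∀ k, z k ≤ γ ^ 2 * w k + (γ * V k - γ * V (k + 1)) := fun k => by
    have h' := mul_le_mul_of_nonneg_left (h k) hγ.le
    have hc : γ * (γ⁻¹ * z k) = z k := by field_simp
    linarith
  have hsum : ∀ n, ∑ k ∈ Finset.range n, z k ≤ γ ^ 2 * ∑' k, w k + γ * V 0 := fun n => by
    have h1 := Finset.sum_le_sum fun k (_ : k ∈ Finset.range n) => hstep k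
    rw [Finset.sum_add_distrib, ← Finset.mul_sum,
      Finset.sum_range_sub' (fun k => γ * V k)] at h1
    have h2 := mul_le_mul_of_nonneg_left
      (hws.sum_le_tsum (Finset.range n) fun k _ => hw k) (sq_nonneg γ)
    have h3 := mul_nonneg hγ.le (hV n)
    linarith
  refine ⟨summable_of_sum_range_le hz hsum, ?_⟩
  have hW : 0 ≤ ∑' k, w k := tsum_nonneg hw
  have hV0 : 0 ≤ γ * V 0 := mul_nonneg hγ.le (hV 0)
  refine Real.sqrt_le_iff.2 ⟨by positivity, ?_⟩
  have hz' := Real.tsum_le_of_sum_range_le hz hsum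
  have hcross : 0 ≤ γ * √(∑' k, w k) * √(γ * V 0) := by positivity
  have e1 := Real.sq_sqrt hW
  have e2 := Real.sq_sqrt hV0
  calc ∑' k, z k ≤ γ ^ 2 * ∑' k, w k + γ * V 0 := hz'
    _ = γ ^ 2 * √(∑' k, w k) ^ 2 + √(γ * V 0) ^ 2 := by rw [e1, e2]
    _ ≤ _ := by nlinarith

section LMI

variable {m p q : Type*} [Fintype m] [DecidableEq m] [Fintype p] [DecidableEq p]
  [Fintype q] [DecidableEq q]

/-- The slack-variable inequality `sᵀ (H + Hᵀ - P) s ≤ (H s)ᵀ P⁻¹ (H s)`. -/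
theorem Matrix.PosDef.dotProduct_slack_le {P : Matrix m m ℝ} (hP : P.PosDef)
    (H : Matrix m m ℝ) (s : m → ℝ) :
    s ⬝ᵥ (H + Hᵀ - P) *ᵥ s ≤ (H *ᵥ s) ⬝ᵥ P⁻¹ *ᵥ (H *ᵥ s) := by
  have hdet : IsUnit P.det := (Matrix.isUnit_iff_isUnit_det P).1 hP.isUnit
  have hcancel : P⁻¹ *ᵥ (P *ᵥ s) = s := by
    rw [mulVec_mulVec, nonsing_inv_mul P hdet, one_mulVec]
  have hnn := hP.inv.posSemidef.dotProduct_mulVec_nonneg (H *ᵥ s - P *ᵥ s)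
  have hPs : (P *ᵥ s) ⬝ᵥ P⁻¹ *ᵥ (H *ᵥ s) = s ⬝ᵥ H *ᵥ s := by
    have hT : P⁻¹ᵀ = P⁻¹ := hP.inv.isHermitian
    rw [dotProduct_mulVec, ← mulVec_transpose, hT, hcancel]
  have hHt : s ⬝ᵥ Hᵀ *ᵥ s = s ⬝ᵥ H *ᵥ s := by
    rw [mulVec_transpose, dotProduct_comm, dotProduct_mulVec]
  simp only [star_trivial, mulVec_sub, hcancel, dotProduct_sub, sub_dotProduct, hPs] at hnn
  rw [dotProduct_comm (H *ᵥ s) s, dotProduct_comm (P *ᵥ s) s] at hnn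
  simp only [add_mulVec, sub_mulVec, dotProduct_add, dotProduct_sub, hHt]
  linarith

/-- The bounded-real type LMI with slack variable `H` implies a dissipation inequality for the
storage `v ↦ vᵀ P⁻¹ v`. -/
theorem dissipation_of_posDef_fromBlocks {γ : ℝ} (hγ : 0 < γ) {P H A : Matrix m m ℝ}
    {B : Matrix m p ℝ} {C : Matrix q m ℝ} {D : Matrix q p ℝ} (hP : P.PosDef)
    (hLMI : (fromBlocks (fromBlocks P A Aᵀ (H + Hᵀ - P)) (fromBlocks B 0 0 Cᵀ)
      (fromBlocks Bᵀ 0 0 C)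
      (fromBlocks (γ • (1 : Matrix p p ℝ)) Dᵀ D (γ • (1 : Matrix q q ℝ)))).PosDef)
    (s : m → ℝ) (w : p → ℝ) :
    (A *ᵥ s + B *ᵥ w) ⬝ᵥ P⁻¹ *ᵥ (A *ᵥ s + B *ᵥ w) ≤
      (H *ᵥ s) ⬝ᵥ P⁻¹ *ᵥ (H *ᵥ s) + γ * (w ⬝ᵥ w) -
        γ⁻¹ * ((C *ᵥ s + D *ᵥ w) ⬝ᵥ (C *ᵥ s + D *ᵥ w)) := by
  have hdet : IsUnit P.det := (Matrix.isUnit_iff_isUnit_det P).1 hP.isUnit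
  set y := A *ᵥ s + B *ᵥ w with hy
  set z := C *ᵥ s + D *ᵥ w with hz
  have hslack := hP.dotProduct_slack_le H s
  have hq := hLMI.posSemidef.dotProduct_mulVec_nonneg
    (Sum.elim (Sum.elim (-(P⁻¹ *ᵥ y)) s) (Sum.elim w (-(γ⁻¹ • z))))
  have hcancel : P *ᵥ (P⁻¹ *ᵥ y) = y := by
    rw [mulVec_mulVec, mul_nonsing_inv P hdet, one_mulVec]
  have hA : s ⬝ᵥ Aᵀ *ᵥ (P⁻¹ *ᵥ y) = (A *ᵥ s) ⬝ᵥ P⁻¹ *ᵥ y := by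
    rw [dotProduct_mulVec, vecMul_transpose]
  have hB : w ⬝ᵥ Bᵀ *ᵥ (P⁻¹ *ᵥ y) = (B *ᵥ w) ⬝ᵥ P⁻¹ *ᵥ y := by
    rw [dotProduct_mulVec, vecMul_transpose]
  have hC : s ⬝ᵥ Cᵀ *ᵥ z = (C *ᵥ s) ⬝ᵥ z := by
    rw [dotProduct_mulVec, vecMul_transpose]
  have hD : w ⬝ᵥ Dᵀ *ᵥ z = (D *ᵥ w) ⬝ᵥ z := by
    rw [dotProduct_mulVec, vecMul_transpose]
  have hyy : y ⬝ᵥ P⁻¹ *ᵥ y = (A *ᵥ s) ⬝ᵥ P⁻¹ *ᵥ y + (B *ᵥ w) ⬝ᵥ P⁻¹ *ᵥ y := by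
    rw [← add_dotProduct]
  have hzz : z ⬝ᵥ z = (C *ᵥ s) ⬝ᵥ z + (D *ᵥ w) ⬝ᵥ z := by
    rw [← add_dotProduct]
  simp only [star_trivial, fromBlocks_mulVec, Sum.elim_comp_inl, Sum.elim_comp_inr,
    sumElim_dotProduct_sumElim, mulVec_neg, mulVec_smul, zero_mulVec, add_zero, zero_add,
    smul_mulVec, one_mulVec, hcancel, dotProduct_add, neg_dotProduct, dotProduct_neg, mul_neg,
    dotProduct_zero, mul_zero, smul_dotProduct, dotProduct_smul, smul_eq_mul, hA, hB, hC, hD,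
    neg_neg] at hq
  rw [dotProduct_comm (P⁻¹ *ᵥ y) y, dotProduct_comm (P⁻¹ *ᵥ y) (A *ᵥ s),
    dotProduct_comm (P⁻¹ *ᵥ y) (B *ᵥ w), dotProduct_comm z (C *ᵥ s),
    dotProduct_comm z (D *ᵥ w)] at hq
  have hγc : γ⁻¹ * (γ * (γ⁻¹ * (z ⬝ᵥ z))) = γ⁻¹ * ((C *ᵥ s) ⬝ᵥ z) + γ⁻¹ * ((D *ᵥ w) ⬝ᵥ z) := by
    rw [mul_inv_cancel_left₀ hγ.ne', hzz, mul_add]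
  rw [hγc, hyy] at hq
  rw [hyy, hzz, mul_add]
  linarith

end LMI

/-- **Lemma 1, differential LPV controller synthesis.**  If the
synthesis LMI (9) is feasible for all `ρ` in the scheduling set, and `R, L` are
invertible with `S = NJ + RL`, then the controller constructed by (11)–(12)
renders the closed loop ℓ₂-gain stable with gain at most `γ`: there is a
positive definite closed-loop storage matrix `Q` such that every closed-loop
trajectory with square-summable `δw` satisfies
`‖δz‖₂ ≤ γ‖δw‖₂ + sqrt(γ · δχ₀ᵀ Q δχ₀)`. -/
theorem differential_lpv_controller_synthesis
    (nx nρ nw nu nz ny : ℕ)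
    (Pset : Set (Fin nρ → ℝ))
    -- the LPV plant
    (A : (Fin nρ → ℝ) → Matrix (Fin nx) (Fin nx) ℝ)
    (Cz : (Fin nρ → ℝ) → Matrix (Fin nz) (Fin nx) ℝ)
    (Bw : Matrix (Fin nx) (Fin nw) ℝ) (Bu : Matrix (Fin nx) (Fin nu) ℝ)
    (Cy : Matrix (Fin ny) (Fin nx) ℝ)
    (Dzw : Matrix (Fin nz) (Fin nw) ℝ) (Dzu : Matrix (Fin nz) (Fin nu) ℝ)
    (Dyw : Matrix (Fin ny) (Fin nw) ℝ)
    -- synthesis variables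
    (γ : ℝ) (hγ : 0 < γ)
    (Px Pz : Matrix (Fin nx) (Fin nx) ℝ) (hPx : Px.PosDef) (hPz : Pz.PosDef)
    (Py J N S : Matrix (Fin nx) (Fin nx) ℝ)
    (Um : (Fin nρ → ℝ) → Matrix (Fin nx) (Fin nx) ℝ)
    (Vm : (Fin nρ → ℝ) → Matrix (Fin nx) (Fin ny) ℝ)
    (Wm : (Fin nρ → ℝ) → Matrix (Fin nu) (Fin nx) ℝ)
    (Xm : (Fin nρ → ℝ) → Matrix (Fin nu) (Fin ny) ℝ)
    -- the synthesis LMI (9), for all ρ in the scheduling set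
    (hLMI : ∀ ρ ∈ Pset,
      (Matrix.fromBlocks
        (Matrix.fromBlocks
          (Matrix.fromBlocks Px Py Pyᵀ Pz)
          (Matrix.fromBlocks (A ρ * J + Bu * Wm ρ) (A ρ + Bu * Xm ρ * Cy)
            (Um ρ) (N * A ρ + Vm ρ * Cy))
          (Matrix.fromBlocks (A ρ * J + Bu * Wm ρ) (A ρ + Bu * Xm ρ * Cy)
            (Um ρ) (N * A ρ + Vm ρ * Cy))ᵀ
          (Matrix.fromBlocks (J + Jᵀ - Px) (1 + Sᵀ - Py) (1 + S - Pyᵀ) (N + Nᵀ - Pz)))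
        (Matrix.fromBlocks
          (Matrix.fromRows (Bw + Bu * Xm ρ * Dyw) (N * Bw + Vm ρ * Dyw)) 0
          0 (Matrix.fromCols (Cz ρ * J + Dzu * Wm ρ) (Cz ρ + Dzu * Xm ρ * Cy))ᵀ)
        (Matrix.fromBlocks
          (Matrix.fromRows (Bw + Bu * Xm ρ * Dyw) (N * Bw + Vm ρ * Dyw))ᵀ 0
          0 (Matrix.fromCols (Cz ρ * J + Dzu * Wm ρ) (Cz ρ + Dzu * Xm ρ * Cy)))
        (Matrix.fromBlocks (γ • (1 : Matrix (Fin nw) (Fin nw) ℝ))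
          (Dzw + Dzu * Xm ρ * Dyw)ᵀ (Dzw + Dzu * Xm ρ * Dyw)
          (γ • (1 : Matrix (Fin nz) (Fin nz) ℝ)))).PosDef)
    -- factorization  S = NJ + RL  with R, L invertible
    (R L : Matrix (Fin nx) (Fin nx) ℝ)
    (hR : IsUnit R.det) (hL : IsUnit L.det)
    (hS : S = N * J + R * L)
    -- the constructed controller matrices (11)–(12)
    (K : (Fin nρ → ℝ) → Matrix (Fin nx ⊕ Fin nu) (Fin nx ⊕ Fin ny) ℝ)
    (hK : ∀ ρ, K ρ =
      (Matrix.fromBlocks R (N * Bu) 0 (1 : Matrix (Fin nu) (Fin nu) ℝ))⁻¹ *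
        (Matrix.fromBlocks (Um ρ) (Vm ρ) (Wm ρ) (Xm ρ) -
          Matrix.fromBlocks (N * A ρ * J) 0 0 0) *
        (Matrix.fromBlocks L 0 (Cy * J) (1 : Matrix (Fin ny) (Fin ny) ℝ))⁻¹)
    (Aδc : (Fin nρ → ℝ) → Matrix (Fin nx) (Fin nx) ℝ)
    (Bδc : (Fin nρ → ℝ) → Matrix (Fin nx) (Fin ny) ℝ)
    (Cδc : (Fin nρ → ℝ) → Matrix (Fin nu) (Fin nx) ℝ)
    (Dδc : (Fin nρ → ℝ) → Matrix (Fin nu) (Fin ny) ℝ)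
    (hAc : ∀ ρ, Aδc ρ = (K ρ).toBlocks₁₁) (hBc : ∀ ρ, Bδc ρ = (K ρ).toBlocks₁₂)
    (hCc : ∀ ρ, Cδc ρ = (K ρ).toBlocks₂₁) (hDc : ∀ ρ, Dδc ρ = (K ρ).toBlocks₂₂) :
    -- conclusion: closed-loop ℓ₂-gain stability with gain at most γ
    ∃ Q : Matrix (Fin nx ⊕ Fin nx) (Fin nx ⊕ Fin nx) ℝ, Q.PosDef ∧
      ∀ ρ : ℕ → Fin nρ → ℝ, (∀ k, ρ k ∈ Pset) →
      ∀ δx δxc : ℕ → Fin nx → ℝ,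
      ∀ δw : ℕ → Fin nw → ℝ, ∀ δu δyc : ℕ → Fin nu → ℝ,
      ∀ δy δuc : ℕ → Fin ny → ℝ, ∀ δz : ℕ → Fin nz → ℝ,
      (∀ k, δx (k + 1) = (A (ρ k)).mulVec (δx k) + Bw.mulVec (δw k) + Bu.mulVec (δu k)) →
      (∀ k, δz k = (Cz (ρ k)).mulVec (δx k) + Dzw.mulVec (δw k) + Dzu.mulVec (δu k)) →
      (∀ k, δy k = Cy.mulVec (δx k) + Dyw.mulVec (δw k)) →
      (∀ k, δxc (k + 1) = (Aδc (ρ k)).mulVec (δxc k) + (Bδc (ρ k)).mulVec (δuc k)) →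
      (∀ k, δyc k = (Cδc (ρ k)).mulVec (δxc k) + (Dδc (ρ k)).mulVec (δuc k)) →
      (∀ k, δu k = δyc k) → (∀ k, δuc k = δy k) →
      (Summable fun k => δw k ⬝ᵥ δw k) →
      (Summable fun k => δz k ⬝ᵥ δz k) ∧
        Real.sqrt (∑' k, δz k ⬝ᵥ δz k) ≤
          γ * Real.sqrt (∑' k, δw k ⬝ᵥ δw k) +
            Real.sqrt (γ * (Sum.elim (δx 0) (δxc 0) ⬝ᵥ
              Q.mulVec (Sum.elim (δx 0) (δxc 0)))) := by
  rcases Pset.eq_empty_or_nonempty with rfl | ⟨ρ₀, hρ₀⟩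
  · exact ⟨1, PosDef.one, fun ρ hρ => absurd (hρ 0) (Set.notMem_empty _)⟩
  set P := fromBlocks Px Py Pyᵀ Pz with hPdef
  have hP : P.PosDef := by
    have h := (hLMI ρ₀ hρ₀).submatrix (e := fun i => Sum.inl (Sum.inl i))
      (Sum.inl_injective.comp Sum.inl_injective)
    exact h
  set T : Matrix (Fin nx ⊕ Fin nx) (Fin nx ⊕ Fin nx) ℝ := fromBlocks 1 0 N R with hT
  set H : Matrix (Fin nx ⊕ Fin nx) (Fin nx ⊕ Fin nx) ℝ := fromBlocks J 1 S N with hH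
  have hG : fromBlocks (J + Jᵀ - Px) (1 + Sᵀ - Py) (1 + S - Pyᵀ) (N + Nᵀ - Pz) =
      H + Hᵀ - P := by
    rw [hH, hPdef, fromBlocks_transpose, fromBlocks_add, sub_eq_add_neg (fromBlocks _ _ _ _),
      fromBlocks_neg,
      fromBlocks_add]
    simp only [transpose_one, sub_eq_add_neg, add_comm S]
  have hTdet : IsUnit T.det := by simpa [hT, det_fromBlocks_zero₁₂] using hR
  have hctrl : ∀ ρ, Um ρ = N * A ρ * J + (R * Aδc ρ + N * Bu * Cδc ρ) * L +
        (R * Bδc ρ + N * Bu * Dδc ρ) * (Cy * J) ∧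
      Vm ρ = R * Bδc ρ + N * Bu * Dδc ρ ∧
      Wm ρ = Cδc ρ * L + Dδc ρ * (Cy * J) ∧ Xm ρ = Dδc ρ := fun ρ => by
    have hE : IsUnit (fromBlocks R (N * Bu) 0 (1 : Matrix (Fin nu) (Fin nu) ℝ)).det := by
      simpa [det_fromBlocks_zero₂₁] using hR
    have hF : IsUnit (fromBlocks L 0 (Cy * J) (1 : Matrix (Fin ny) (Fin ny) ℝ)).det := by
      simpa [det_fromBlocks_zero₁₂] using hL
    have hKb : K ρ = fromBlocks (Aδc ρ) (Bδc ρ) (Cδc ρ) (Dδc ρ) := by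
      rw [hAc, hBc, hCc, hDc, fromBlocks_toBlocks]
    have hprod : fromBlocks R (N * Bu) 0 (1 : Matrix (Fin nu) (Fin nu) ℝ) * K ρ *
        fromBlocks L 0 (Cy * J) (1 : Matrix (Fin ny) (Fin ny) ℝ) =
        fromBlocks (Um ρ) (Vm ρ) (Wm ρ) (Xm ρ) - fromBlocks (N * A ρ * J) 0 0 0 := by
      rw [hK, Matrix.mul_assoc _⁻¹, mul_nonsing_inv_cancel_left _ _ hE,
        nonsing_inv_mul_cancel_right _ _ hF]
    rw [hKb, fromBlocks_multiply, fromBlocks_multiply, eq_sub_iff_add_eq, fromBlocks_add,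
      fromBlocks_inj] at hprod
    obtain ⟨h1, h2, h3, h4⟩ := hprod
    simp only [Matrix.zero_mul, Matrix.mul_zero, Matrix.one_mul, Matrix.mul_one, zero_add,
      add_zero] at h1 h2 h3 h4
    exact ⟨by rw [← h1]; abel, h2.symm, h3.symm, h4.symm⟩
  refine ⟨Tᵀ * P⁻¹ * T, ?_, ?_⟩
  · have h := hP.inv.conjTranspose_mul_mul_same (B := T)
      (mulVec_injective_iff_isUnit.2 ((isUnit_iff_isUnit_det T).2 hTdet))
    rwa [conjTranspose_eq_transpose_of_trivial] at h
  intro ρ hρ x xc w u yc y uc z hx hz hy hxc hyc hu huc hw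
  have hquad : ∀ v, v ⬝ᵥ (Tᵀ * P⁻¹ * T) *ᵥ v = (T *ᵥ v) ⬝ᵥ P⁻¹ *ᵥ (T *ᵥ v) := fun v => by
    rw [← mulVec_mulVec, ← mulVec_mulVec, dotProduct_mulVec, vecMul_transpose]
  have hnn : ∀ v, 0 ≤ v ⬝ᵥ P⁻¹ *ᵥ v := fun v => by
    simpa only [star_trivial] using hP.inv.posSemidef.dotProduct_mulVec_nonneg v
  rw [hquad]
  refine summable_and_sqrt_tsum_le_of_dissipation hγ
    (V := fun k => (T *ᵥ Sum.elim (x k) (xc k)) ⬝ᵥ P⁻¹ *ᵥ (T *ᵥ Sum.elim (x k) (xc k)))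
    (fun k => hnn _)
    (fun k => by simpa using dotProduct_star_self_nonneg (w k))
    (fun k => by simpa using dotProduct_star_self_nonneg (z k)) hw fun k => ?_
  have hLMIk := hLMI (ρ k) (hρ k)
  rw [hG] at hLMIk
  obtain ⟨s, hs⟩ : ∃ s, L *ᵥ s = xc k := ⟨L⁻¹ *ᵥ xc k, by
    rw [mulVec_mulVec, mul_nonsing_inv L hL, one_mulVec]⟩
  have hdis := dissipation_of_posDef_fromBlocks hγ hP hLMIk (Sum.elim s (x k - J *ᵥ s)) (w k)
  obtain ⟨hU, hV, hW, hX⟩ := hctrl (ρ k)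
  have hstate : H *ᵥ Sum.elim s (x k - J *ᵥ s) = T *ᵥ Sum.elim (x k) (xc k) := by
    rw [← hs]
    simp only [hH, hT, hS, fromBlocks_mulVec, Sum.elim_comp_inl, Sum.elim_comp_inr, one_mulVec,
      zero_mulVec, add_mulVec, mulVec_sub, ← mulVec_mulVec]
    congr 1 <;> abel
  have hinput : u k = Wm (ρ k) *ᵥ s + Xm (ρ k) *ᵥ (Cy *ᵥ (x k - J *ᵥ s) + Dyw *ᵥ w k) := by
    rw [hu, hyc, huc, hy, ← hs, hW, hX]
    simp only [add_mulVec, mulVec_add, mulVec_sub, ← mulVec_mulVec]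
    abel
  have hnext : fromBlocks (A (ρ k) * J + Bu * Wm (ρ k)) (A (ρ k) + Bu * Xm (ρ k) * Cy)
        (Um (ρ k)) (N * A (ρ k) + Vm (ρ k) * Cy) *ᵥ Sum.elim s (x k - J *ᵥ s) +
      fromRows (Bw + Bu * Xm (ρ k) * Dyw) (N * Bw + Vm (ρ k) * Dyw) *ᵥ w k =
      T *ᵥ Sum.elim (x (k + 1)) (xc (k + 1)) := by
    rw [hx, hinput, hxc, huc, hy, ← hs, hU, hV, hW, hX]
    simp only [hT, fromBlocks_mulVec, fromRows_mulVec, ← Sum.elim_add_add, Sum.elim_comp_inl,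
      Sum.elim_comp_inr, one_mulVec, zero_mulVec, add_mulVec, mulVec_add, mulVec_sub,
      Matrix.add_mul, ← mulVec_mulVec]
    congr 1 <;> abel
  have hout : fromCols (Cz (ρ k) * J + Dzu * Wm (ρ k)) (Cz (ρ k) + Dzu * Xm (ρ k) * Cy) *ᵥ
        Sum.elim s (x k - J *ᵥ s) + (Dzw + Dzu * Xm (ρ k) * Dyw) *ᵥ w k = z k := by
    rw [hz, hinput]
    simp only [fromCols_mulVec, Sum.elim_comp_inl, Sum.elim_comp_inr, add_mulVec, mulVec_add,
      mulVec_sub, ← mulVec_mulVec]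
    abel
  rwa [hnext, hout, hstate] at hdis
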